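/- Let R be a commutative ring and ε : R → ℤ a ring homomorphism whose kernel I = ker(ε) satisfies I² = 0 (i.e. xy = 0 for all x, y ∈ I). Then there is a ring isomorphism between R and the trivial square-zero extension E(I) = ℤ ⊕ I, whose underlying additive group is ℤ × I and whose multiplication is (a, m)·(b, n) = (ab, a·n + b·m), such that under this isomorphism ε corresponds to the projection (a, m) ↦ a onto the first factor. -/

import Mathlib

/-- Any additive commutative group is a module over `ℤᵐᵒᵖ`, via the canonical (unique)
`ℤ`-module structure. -/
noncomputable instance intOppositeModule (M : Type*) [AddCommGroup M] : Module ℤᵐᵒᵖ M :=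
  Module.compHom M ((RingHom.id ℤ).fromOpposite fun _ _ => mul_comm _ _)

instance intIsCentralScalar (M : Type*) [AddCommGroup M] : IsCentralScalar ℤ M :=
  ⟨fun _ _ => rfl⟩

/-- Let `R` be a commutative ring and `ε : R → ℤ` a ring homomorphism whose kernel `I`
satisfies `I² = 0`.  Then `R` is isomorphic, as a ring, to the trivial square-zero
extension `E(I) = ℤ ⊕ I` (with multiplication `(a, m)·(b, n) = (ab, a·n + b·m)`), in such
a way that `ε` corresponds to the projection onto the first factor. -/
theorem elementary_augmented_ring_iso_trivSqZeroExt
    {R : Type*} [CommRing R] (ε : R →+* ℤ)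
    (hsq : ∀ x y : R, x ∈ RingHom.ker ε → y ∈ RingHom.ker ε → x * y = 0) :
    ∃ e : R ≃+* TrivSqZeroExt ℤ (RingHom.ker ε),
      ∀ r : R, (e r).fst = ε r := by
  have hk : ∀ r : R, r - (ε r : R) ∈ RingHom.ker ε := fun r => by
    simp [RingHom.mem_ker]
  refine ⟨{ toFun := fun r => (ε r, ⟨r - (ε r : R), hk r⟩)
            invFun := fun x => (x.fst : R) + (x.snd : R)
            left_inv := ?_
            right_inv := ?_
            map_mul' := ?_
            map_add' := ?_ }, ?_⟩
  · intro r
    change (ε r : R) + (r - (ε r : R)) = r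
    ring
  · intro x
    have hx : ε (x.snd : R) = 0 := x.snd.2
    have h1 : ε ((x.fst : R) + (x.snd : R)) = x.fst := by simp [hx]
    refine TrivSqZeroExt.ext h1 (Subtype.ext ?_)
    change (x.fst : R) + (x.snd : R) - (ε ((x.fst : R) + (x.snd : R)) : R) = (x.snd : R)
    rw [h1]
    ring
  · intro r s
    refine TrivSqZeroExt.ext (map_mul ε r s) (Subtype.ext ?_)
    have h := hsq _ _ (hk r) (hk s)
    change r * s - (ε (r * s) : R) =
      ((ε r • (⟨s - (ε s : R), hk s⟩ : RingHom.ker ε)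
        + ε s • (⟨r - (ε r : R), hk r⟩ : RingHom.ker ε) : RingHom.ker ε) : R)
    rw [Submodule.coe_add, Submodule.coe_smul_of_tower, Submodule.coe_smul_of_tower,
      zsmul_eq_mul, zsmul_eq_mul, map_mul, Int.cast_mul]
    linear_combination h
  · intro r s
    refine TrivSqZeroExt.ext (map_add ε r s) (Subtype.ext ?_)
    change r + s - (ε (r + s) : R) = (r - (ε r : R)) + (s - (ε s : R))
    rw [map_add, Int.cast_add]
    ring
  · intro r
    rfl
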